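/- Let H be a cocommutative Hopf algebra over a field k and σ : H⊗H → k a convolution invertible, normal 2-cocycle (for the trivial action of H on k). Let H_σ denote the twisted algebra k#_σH, and let M be an H_σ-bimodule. Then the formula h▶m = σ⁻¹(S(h⁽²⁾),h⁽³⁾) · (overline{h⁽⁴⁾} m overline{S(h⁽¹⁾)}) defines a left H-module structure on M, i.e. g▶(h▶m) = (gh)▶m for all g,h ∈ H and m ∈ M, and 1▶m = m. -/

import Mathlib

open TensorProduct

noncomputable section

/-! ## Tensor powers, iterated comultiplication and Sweedler representations -/

/-- `Tpow k V n` is the `(n+1)`-fold tensor power `V ⊗ V ⊗ ⋯ ⊗ V` (`n+1` factors),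
bundled as an object of `ModuleCat k`. -/
def Tpow (k : Type) [Field k] (V : Type) [AddCommGroup V] [Module k V] : ℕ → ModuleCat k
  | 0 => ModuleCat.of k V
  | n + 1 => ModuleCat.of k (V ⊗[k] (Tpow k V n))

/-- The elementary tensor `f 0 ⊗ f 1 ⊗ ⋯ ⊗ f n` in `Tpow k V n`. -/
def tpow (k : Type) [Field k] (V : Type) [AddCommGroup V] [Module k V] :
    (n : ℕ) → (Fin (n + 1) → V) → Tpow k V n
  | 0, f => (f 0 : V)
  | n + 1, f => (f 0 ⊗ₜ[k] tpow k V n (fun i => f i.succ) : V ⊗[k] Tpow k V n)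

/-- The iterated comultiplication `Δ⁽ⁿ⁾ : H → H^{⊗(n+1)}`, `Δ⁽⁰⁾ = id`,
`Δ⁽ⁿ⁺¹⁾ = (1 ⊗ Δ⁽ⁿ⁾) ∘ Δ`. -/
def comulIter (k : Type) [Field k] (H : Type) [Ring H] [HopfAlgebra k H] :
    (n : ℕ) → H →ₗ[k] Tpow k H n
  | 0 => LinearMap.id
  | n + 1 =>
    (LinearMap.lTensor H (comulIter k H n) ∘ₗ Coalgebra.comul :
      H →ₗ[k] (H ⊗[k] Tpow k H n))

/-- A finite Sweedler-type representation `Δ⁽ⁿ⁾ h = ∑ᵢ h⁽¹⁾ᵢ ⊗ ⋯ ⊗ h⁽ⁿ⁺¹⁾ᵢ` of the iterated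
comultiplication of `h`; `leg i j` is the `(j+1)`-st Sweedler leg of the `i`-th summand. -/
structure IterRepr (k : Type) [Field k] (H : Type) [Ring H] [HopfAlgebra k H]
    (n : ℕ) (h : H) where
  ι : Type
  s : Finset ι
  leg : ι → Fin (n + 1) → H
  eq : ∑ i ∈ s, tpow k H n (leg i) = comulIter k H n h

/-- Merge an `(n+1)`-tuple to an `n`-tuple, replacing the two entries at positions `i, i+1`
by the single entry `v`. -/
def mergeAt {V : Type} {n : ℕ} (i : Fin n) (x : Fin (n + 1) → V) (v : V) :
    Fin n → V :=
  fun j => if (j : ℕ) < (i : ℕ) then x (Fin.castSucc j) else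
    if (j : ℕ) = (i : ℕ) then v else x j.succ

variable (k : Type) [Field k] (H : Type) [Ring H] [HopfAlgebra k H]

/-- `H` is cocommutative. -/
def Cocomm : Prop :=
  ∀ h : H, (TensorProduct.comm k H H) (Coalgebra.comul (R := k) h) = Coalgebra.comul (R := k) h

variable (A : Type) [Ring A] [Algebra k A]
variable (rho : H →ₗ[k] A →ₗ[k] A)

/-- `rho` is a weak action of `H` on `A`:
`h(ab) = h⁽¹⁾(a)h⁽²⁾(b)`, `h(1) = ε(h)1` and `1(a) = a`. -/
def IsWeakAction : Prop :=
  (∀ (h : H) (a b : A) (R : IterRepr k H 1 h),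
      rho h (a * b) = ∑ i ∈ R.s, rho (R.leg i 0) a * rho (R.leg i 1) b) ∧
  (∀ h : H, rho h (1 : A) = Coalgebra.counit (R := k) h • (1 : A)) ∧
  (∀ a : A, rho 1 a = a)

/-- `rho` makes `A` a left `H`-module algebra: a weak action which is an action. -/
def IsModuleAlgebraAction : Prop :=
  IsWeakAction k H A rho ∧ (∀ (h l : H) (a : A), rho (h * l) a = rho h (rho l a))

variable (sg : H →ₗ[k] H →ₗ[k] k)

/-- Normality for a `k`-valued cocycle: `σ(h,1) = σ(1,h) = ε(h)`. -/
def NormalK : Prop :=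
  ∀ h : H, sg h 1 = Coalgebra.counit (R := k) h ∧ sg 1 h = Coalgebra.counit (R := k) h

/-- The cocycle property for a `k`-valued cocycle:
`σ(l⁽¹⁾,m⁽¹⁾)σ(h,l⁽²⁾m⁽²⁾) = σ(h⁽¹⁾,l⁽¹⁾)σ(h⁽²⁾l⁽²⁾,m)`. -/
def CocycleK : Prop :=
  ∀ (h l m : H) (Rh : IterRepr k H 1 h) (Rl : IterRepr k H 1 l) (Rm : IterRepr k H 1 m),
    ∑ j ∈ Rl.s, ∑ c ∈ Rm.s,
        sg (Rl.leg j 0) (Rm.leg c 0) * sg h (Rl.leg j 1 * Rm.leg c 1) =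
      ∑ i ∈ Rh.s, ∑ j ∈ Rl.s,
        sg (Rh.leg i 0) (Rl.leg j 0) * sg (Rh.leg i 1 * Rl.leg j 1) m

/-- The twisted module property for a `k`-valued cocycle:
`h⁽¹⁾(l⁽¹⁾(a))σ(h⁽²⁾,l⁽²⁾) = σ(h⁽¹⁾,l⁽¹⁾)(h⁽²⁾l⁽²⁾)(a)`. -/
def TwistedModuleK : Prop :=
  ∀ (h l : H) (a : A) (Rh : IterRepr k H 1 h) (Rl : IterRepr k H 1 l),
    ∑ i ∈ Rh.s, ∑ j ∈ Rl.s,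
        sg (Rh.leg i 1) (Rl.leg j 1) • rho (Rh.leg i 0) (rho (Rl.leg j 0) a) =
      ∑ i ∈ Rh.s, ∑ j ∈ Rl.s,
        sg (Rh.leg i 0) (Rl.leg j 0) • rho (Rh.leg i 1 * Rl.leg j 1) a

/-- The `k`-valued map `σ`, viewed in the convolution algebra `Hom_k(H ⊗ H, A)` via
`x ⊗ y ↦ σ(x,y)1_A`, is convolution invertible. -/
def ConvInvertibleK : Prop :=
  ∃ sg' : H →ₗ[k] H →ₗ[k] A,
    ∀ (h l : H) (Rh : IterRepr k H 1 h) (Rl : IterRepr k H 1 l),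
      (∑ i ∈ Rh.s, ∑ j ∈ Rl.s,
          (sg (Rh.leg i 0) (Rl.leg j 0) • (1 : A)) * sg' (Rh.leg i 1) (Rl.leg j 1) =
        (Coalgebra.counit (R := k) h * Coalgebra.counit (R := k) l) • (1 : A)) ∧
      (∑ i ∈ Rh.s, ∑ j ∈ Rl.s,
          sg' (Rh.leg i 0) (Rl.leg j 0) * (sg (Rh.leg i 1) (Rl.leg j 1) • (1 : A)) =
        (Coalgebra.counit (R := k) h * Coalgebra.counit (R := k) l) • (1 : A))

/-! ## The twisted algebra `H_σ = k #_σ H` and `H_σ`-bimodules -/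

variable (M : Type) [AddCommGroup M] [Module k M]
variable (mu : H →ₗ[k] H →ₗ[k] H) (sg' : H →ₗ[k] H →ₗ[k] k)
variable (lact ract : H →ₗ[k] M →ₗ[k] M)

/-- Spec of the multiplication of the twisted algebra `H_σ = k #_σ H` (underlying space `H`):
`h̄ · ḡ = σ(h⁽¹⁾,g⁽¹⁾) (h⁽²⁾g⁽²⁾)‾`. -/
def IsTwistMul : Prop :=
  ∀ (h g : H) (Rh : IterRepr k H 1 h) (Rg : IterRepr k H 1 g),
    mu h g = ∑ i ∈ Rh.s, ∑ j ∈ Rg.s,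
      sg (Rh.leg i 0) (Rg.leg j 0) • (Rh.leg i 1 * Rg.leg j 1)

/-- `sg'` is the convolution inverse of `sg` in the convolution algebra `Hom_k(H ⊗ H, k)`. -/
def IsConvInvPair : Prop :=
  ∀ (h l : H) (Rh : IterRepr k H 1 h) (Rl : IterRepr k H 1 l),
    (∑ i ∈ Rh.s, ∑ j ∈ Rl.s,
        sg (Rh.leg i 0) (Rl.leg j 0) * sg' (Rh.leg i 1) (Rl.leg j 1) =
      Coalgebra.counit (R := k) h * Coalgebra.counit (R := k) l) ∧
    (∑ i ∈ Rh.s, ∑ j ∈ Rl.s,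
        sg' (Rh.leg i 0) (Rl.leg j 0) * sg (Rh.leg i 1) (Rl.leg j 1) =
      Coalgebra.counit (R := k) h * Coalgebra.counit (R := k) l)

/-- `(lact, ract)` is an `H_σ`-bimodule structure on `M` (where `H_σ` has multiplication `mu`
and unit `1̄ = 1`): commuting left and right `H_σ`-module structures. -/
def IsSigmaBimodule : Prop :=
  (∀ (h h' : H) (m : M), lact h (lact h' m) = lact (mu h h') m) ∧
  (∀ m : M, lact 1 m = m) ∧
  (∀ (h h' : H) (m : M), ract h' (ract h m) = ract (mu h h') m) ∧
  (∀ m : M, ract 1 m = m) ∧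
  (∀ (h h' : H) (m : M), lact h (ract h' m) = ract h' (lact h m))

/-- Spec of the operation `h ▶ m = σ⁻¹(S(h⁽²⁾),h⁽³⁾) · (h⁽⁴⁾)‾ m (S(h⁽¹⁾))‾`. -/
def IsTriangle (B : H →ₗ[k] M →ₗ[k] M) : Prop :=
  ∀ (h : H) (m : M) (R : IterRepr k H 3 h),
    B h m = ∑ i ∈ R.s,
      sg' (HopfAlgebra.antipode (R := k) (R.leg i 1)) (R.leg i 2) •
        lact (R.leg i 3) (ract (HopfAlgebra.antipode (R := k) (R.leg i 0)) m)

/-- `TpowM k H M n` is `H^{⊗n} ⊗ M` (with `n` factors of `H`). -/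
def TpowM (k : Type) [Field k] (H : Type) [Ring H] [HopfAlgebra k H]
    (M : Type) [AddCommGroup M] [Module k M] : ℕ → ModuleCat k
  | 0 => ModuleCat.of k M
  | n + 1 => ModuleCat.of k (H ⊗[k] (TpowM k H M n))

/-- The elementary tensor `f 0 ⊗ ⋯ ⊗ f (n-1) ⊗ m` in `TpowM k H M n`. -/
def tpowM (k : Type) [Field k] (H : Type) [Ring H] [HopfAlgebra k H]
    (M : Type) [AddCommGroup M] [Module k M] :
    (n : ℕ) → (Fin n → H) → M → TpowM k H M n
  | 0, _, m => (m : M)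
  | n + 1, f, m =>
    (f 0 ⊗ₜ[k] tpowM k H M n (fun i => f i.succ) m : H ⊗[k] TpowM k H M n)

/-- Spec of the `0`-th face of the Hochschild complex `C_•(H_σ, M)`:
`δ₀(h̄₁ ⊗ ⋯ ⊗ h̄_{n+1} ⊗ m) = h̄₂ ⊗ ⋯ ⊗ h̄_{n+1} ⊗ m·h̄₁`. -/
def IsHochFace0 (n : ℕ) (D : (TpowM k H M (n + 1) : Type) →ₗ[k] (TpowM k H M n : Type)) :
    Prop :=
  ∀ (f : Fin (n + 1) → H) (m : M),
    D (tpowM k H M (n + 1) f m) = tpowM k H M n (fun i => f i.succ) (ract (f 0) m)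

/-- Spec of the middle face `δ_{i+1}` (`0 ≤ i < n`) of the Hochschild complex `C_•(H_σ, M)`:
it multiplies `h̄_{i+1}·h̄_{i+2}` in `H_σ`. -/
def IsHochFaceMid (n : ℕ) (i : Fin n)
    (D : (TpowM k H M (n + 1) : Type) →ₗ[k] (TpowM k H M n : Type)) : Prop :=
  ∀ (f : Fin (n + 1) → H) (m : M),
    D (tpowM k H M (n + 1) f m) =
      tpowM k H M n (mergeAt i f (mu (f i.castSucc) (f i.succ))) m

/-- Spec of the last face of the Hochschild complex `C_•(H_σ, M)`:
`δ_{n+1}(h̄₁ ⊗ ⋯ ⊗ h̄_{n+1} ⊗ m) = h̄₁ ⊗ ⋯ ⊗ h̄ₙ ⊗ h̄_{n+1}·m`. -/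
def IsHochFaceLast (n : ℕ)
    (D : (TpowM k H M (n + 1) : Type) →ₗ[k] (TpowM k H M n : Type)) : Prop :=
  ∀ (f : Fin (n + 1) → H) (m : M),
    D (tpowM k H M (n + 1) f m) =
      tpowM k H M n (fun i => f i.castSucc) (lact (f (Fin.last n)) m)

/-- Spec of the degeneracy inserting the unit `1` at slot `i`
(the same formula in both complexes, since `1̄ = 1`). -/
def IsDegen (n : ℕ) (i : Fin (n + 1))
    (D : (TpowM k H M n : Type) →ₗ[k] (TpowM k H M (n + 1) : Type)) : Prop :=
  ∀ (f : Fin n → H) (m : M),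
    D (tpowM k H M n f m) = tpowM k H M (n + 1) (i.insertNth 1 f) m

/-- Spec of the `0`-th face of the Hopf homology complex `C_•(H; M̃)`:
`d₀(h₁ ⊗ ⋯ ⊗ h_{n+1} ⊗ m) = ε(h₁) h₂ ⊗ ⋯ ⊗ h_{n+1} ⊗ m`. -/
def IsHopfFace0 (n : ℕ) (D : (TpowM k H M (n + 1) : Type) →ₗ[k] (TpowM k H M n : Type)) :
    Prop :=
  ∀ (f : Fin (n + 1) → H) (m : M),
    D (tpowM k H M (n + 1) f m) =
      Coalgebra.counit (R := k) (f 0) • tpowM k H M n (fun i => f i.succ) m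

/-- Spec of the middle face `d_{i+1}` (`0 ≤ i < n`) of the Hopf homology complex
`C_•(H; M̃)`: it multiplies `h_{i+1}h_{i+2}` in `H`. -/
def IsHopfFaceMid (n : ℕ) (i : Fin n)
    (D : (TpowM k H M (n + 1) : Type) →ₗ[k] (TpowM k H M n : Type)) : Prop :=
  ∀ (f : Fin (n + 1) → H) (m : M),
    D (tpowM k H M (n + 1) f m) =
      tpowM k H M n (mergeAt i f (f i.castSucc * f i.succ)) m

/-- Spec of the last face of the Hopf homology complex `C_•(H; M̃)`:
`d_{n+1}(h₁ ⊗ ⋯ ⊗ h_{n+1} ⊗ m) = h₁ ⊗ ⋯ ⊗ hₙ ⊗ h_{n+1} ▶ m`. -/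
def IsHopfFaceLast (B : H →ₗ[k] M →ₗ[k] M) (n : ℕ)
    (D : (TpowM k H M (n + 1) : Type) →ₗ[k] (TpowM k H M n : Type)) : Prop :=
  ∀ (f : Fin (n + 1) → H) (m : M),
    D (tpowM k H M (n + 1) f m) =
      tpowM k H M n (fun i => f i.castSucc) (B (f (Fin.last n)) m)

/-- Spec of the map `Θ : C_n(H_σ, M) → C_n(H; M̃)`:
`Θ(h̄₁ ⊗ ⋯ ⊗ h̄ₙ ⊗ m) = h₁⁽²⁾ ⊗ ⋯ ⊗ hₙ⁽²⁾ ⊗ m·h̄₁⁽¹⁾⋯h̄ₙ⁽¹⁾`. -/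
def IsTheta (n : ℕ) (Th : (TpowM k H M n : Type) →ₗ[k] (TpowM k H M n : Type)) : Prop :=
  ∀ (f : Fin n → H) (m : M) (R : ∀ i : Fin n, IterRepr k H 1 (f i)),
    Th (tpowM k H M n f m) =
      ∑ e ∈ Fintype.piFinset (fun i => (R i).s),
        tpowM k H M n (fun i => (R i).leg (e i) 1)
          ((List.ofFn (fun i : Fin n => (R i).leg (e i) 0)).foldl
            (fun m' h => ract h m') m)

/-- Spec of the map `𝔗 : C_n(H; M̃) → C_n(H_σ, M)`:
`𝔗(h₁ ⊗ ⋯ ⊗ hₙ ⊗ m) = σ⁻¹(S(h₁⁽²⁾),h₁⁽³⁾)⋯σ⁻¹(S(hₙ⁽²⁾),hₙ⁽³⁾) ·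
h̄₁⁽⁴⁾ ⊗ ⋯ ⊗ h̄ₙ⁽⁴⁾ ⊗ m·(S(hₙ⁽¹⁾))‾⋯(S(h₁⁽¹⁾))‾`. -/
def IsTfrak (n : ℕ) (T : (TpowM k H M n : Type) →ₗ[k] (TpowM k H M n : Type)) : Prop :=
  ∀ (f : Fin n → H) (m : M) (R : ∀ i : Fin n, IterRepr k H 3 (f i)),
    T (tpowM k H M n f m) =
      ∑ e ∈ Fintype.piFinset (fun i => (R i).s),
        (∏ i : Fin n,
            sg' (HopfAlgebra.antipode (R := k) ((R i).leg (e i) 1)) ((R i).leg (e i) 2)) •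
          tpowM k H M n (fun i => (R i).leg (e i) 3)
            (((List.ofFn (fun i : Fin n => (R i).leg (e i) 0)).reverse).foldl
              (fun m' h => ract (HopfAlgebra.antipode (R := k) h) m') m)


open Coalgebra WithConv

namespace ConvPoint

section Pair

variable {R C D U V W E : Type*} [CommRing R]
  [AddCommGroup C] [Module R C] [Coalgebra R C]
  [AddCommGroup D] [Module R D] [Coalgebra R D]
  [AddCommGroup U] [Module R U] [Coalgebra R U]
  [AddCommGroup V] [Module R V] [Coalgebra R V]
  [AddCommGroup W] [Module R W] [Coalgebra R W]
  [Ring E] [Algebra R E]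

/-- The pullback of a linear map along a coalgebra map, as an element of the convolution ring. -/
def pull (f : D →ₗ[R] E) (u : C →ₗc[R] D) : WithConv (C →ₗ[R] E) :=
  toConv (f ∘ₗ u.toLinearMap)

lemma pull_convMul (f g : WithConv (D →ₗ[R] E)) (u : C →ₗc[R] D) :
    pull (f * g).ofConv u = pull f.ofConv u * pull g.ofConv u := by
  apply ofConv_injective
  exact LinearMap.convMul_comp_coalgHom_distrib f g u

lemma pull_convOne (u : C →ₗc[R] D) : pull (1 : WithConv (D →ₗ[R] E)).ofConv u = 1 := by
  ext x
  simp [pull]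

lemma pull_pull (f : U →ₗ[R] E) (v : D →ₗc[R] U) (u : C →ₗc[R] D) :
    pull (pull f v).ofConv u = pull f (v.comp u) := rfl

variable (R E C) in
/-- The map of convolution rings induced by the structure map of an algebra. -/
def scalar : WithConv (C →ₗ[R] R) →+* WithConv (C →ₗ[R] E) where
  toFun f := toConv (Algebra.linearMap R E ∘ₗ f.ofConv)
  map_one' := by ext x; simp
  map_mul' f g := by
    apply ofConv_injective
    exact LinearMap.algHom_comp_convMul_distrib (Algebra.ofId R E) f g
  map_zero' := by ext x; simp
  map_add' f g := by ext x; simp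

lemma pull_scalar (f : WithConv (D →ₗ[R] R)) (u : C →ₗc[R] D) :
    pull (scalar R D E f).ofConv u = scalar R C E (pull f.ofConv u) := rfl

lemma coalgHom_ext {u v : C →ₗc[R] U} (h : u.toLinearMap = v.toLinearMap) : u = v :=
  CoalgHom.ext fun x => congr($h x)

variable [IsCocomm R C]

lemma convMul_comm_of_commute (f g : WithConv (C →ₗ[R] E))
    (hfg : ∀ x y, f.ofConv x * g.ofConv y = g.ofConv y * f.ofConv x) : f * g = g * f := by
  ext x
  rw [LinearMap.convMul_apply, ← comm_comul R x, TensorProduct.map_comm, LinearMap.convMul_apply]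
  induction comul (R := R) x using TensorProduct.induction_on with
  | zero => simp
  | add a b ha hb => simp only [map_add, ha, hb]
  | tmul a b => simp [hfg]

lemma scalar_mul_comm (r : WithConv (C →ₗ[R] R)) (f : WithConv (C →ₗ[R] E)) :
    scalar R C E r * f = f * scalar R C E r :=
  convMul_comm_of_commute _ _ fun x y => Algebra.commutes (r.ofConv x) (f.ofConv y)

/-- The coalgebra map `x ↦ a x⁽¹⁾ ⊗ b x⁽²⁾` out of a cocommutative coalgebra. -/
def pair (a : C →ₗc[R] U) (b : C →ₗc[R] V) : C →ₗc[R] U ⊗[R] V :=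
  (Coalgebra.TensorProduct.map a b).comp (comulCoalgHom R C)

lemma pair_toLinearMap (a : C →ₗc[R] U) (b : C →ₗc[R] V) :
    (pair a b).toLinearMap = TensorProduct.map a.toLinearMap b.toLinearMap ∘ₗ comul := rfl

lemma pair_comp [IsCocomm R D] (a : C →ₗc[R] U) (b : C →ₗc[R] V) (u : D →ₗc[R] C) :
    (pair a b).comp u = pair (a.comp u) (b.comp u) := by
  apply coalgHom_ext
  change (TensorProduct.map a.toLinearMap b.toLinearMap ∘ₗ comul) ∘ₗ u.toLinearMap =
    TensorProduct.map (a.toLinearMap ∘ₗ u.toLinearMap) (b.toLinearMap ∘ₗ u.toLinearMap) ∘ₗ comul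
  rw [TensorProduct.map_comp, LinearMap.comp_assoc, LinearMap.comp_assoc, CoalgHom.map_comp_comul]

lemma comm_comp_pair (a : C →ₗc[R] U) (b : C →ₗc[R] V) :
    (TensorProduct.comm R V U).toLinearMap ∘ₗ (pair b a).toLinearMap = (pair a b).toLinearMap := by
  ext x
  simp only [pair_toLinearMap, LinearMap.comp_apply, LinearEquiv.coe_coe]
  rw [← TensorProduct.map_comm, comm_comul]

lemma map_comp_pair {U' V' : Type*} [AddCommGroup U'] [Module R U'] [Coalgebra R U']
    [AddCommGroup V'] [Module R V'] [Coalgebra R V']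
    (f : U →ₗc[R] U') (g : V →ₗc[R] V') (a : C →ₗc[R] U) (b : C →ₗc[R] V) :
    (Coalgebra.TensorProduct.map f g).comp (pair a b) = pair (f.comp a) (g.comp b) := by
  apply coalgHom_ext
  change TensorProduct.map f.toLinearMap g.toLinearMap ∘ₗ
      TensorProduct.map a.toLinearMap b.toLinearMap ∘ₗ comul =
    TensorProduct.map (f.toLinearMap ∘ₗ a.toLinearMap) (g.toLinearMap ∘ₗ b.toLinearMap) ∘ₗ comul
  rw [TensorProduct.map_comp, LinearMap.comp_assoc]

variable (R U V) in
/-- The first projection `x ⊗ y ↦ ε(y) x`. -/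
def fst : U ⊗[R] V →ₗc[R] U :=
  (Coalgebra.TensorProduct.rid R R U).toCoalgHom.comp
    (Coalgebra.TensorProduct.map (CoalgHom.id R U) (counitCoalgHom R V))

variable (R U V) in
/-- The second projection `x ⊗ y ↦ ε(x) y`. -/
def snd : U ⊗[R] V →ₗc[R] V :=
  (Coalgebra.TensorProduct.lid R V).toCoalgHom.comp
    (Coalgebra.TensorProduct.map (counitCoalgHom R U) (CoalgHom.id R V))

lemma fst_tmul (x : U) (y : V) : fst R U V (x ⊗ₜ y) = counit (R := R) y • x := rfl

lemma snd_tmul (x : U) (y : V) : snd R U V (x ⊗ₜ y) = counit (R := R) x • y := rfl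

lemma fst_comp_pair (a : C →ₗc[R] U) (b : C →ₗc[R] V) : (fst R U V).comp (pair a b) = a := by
  apply coalgHom_ext
  change (TensorProduct.rid R U).toLinearMap ∘ₗ (TensorProduct.map LinearMap.id counit ∘ₗ
    TensorProduct.map a.toLinearMap b.toLinearMap) ∘ₗ comul = a.toLinearMap
  rw [← TensorProduct.map_comp, CoalgHom.counit_comp, LinearMap.id_comp,
    CoassocSimps.map_counit_comp_comul_right]
  ext x
  simp

lemma snd_comp_pair (a : C →ₗc[R] U) (b : C →ₗc[R] V) : (snd R U V).comp (pair a b) = b := by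
  apply coalgHom_ext
  change (TensorProduct.lid R V).toLinearMap ∘ₗ (TensorProduct.map counit LinearMap.id ∘ₗ
    TensorProduct.map a.toLinearMap b.toLinearMap) ∘ₗ comul = b.toLinearMap
  rw [← TensorProduct.map_comp, CoalgHom.counit_comp, LinearMap.id_comp,
    CoassocSimps.map_counit_comp_comul_left]
  ext x
  simp

lemma assoc_comp_pair (a : C →ₗc[R] U) (b : C →ₗc[R] V) (c : C →ₗc[R] W) :
    (Coalgebra.TensorProduct.assoc R R U V W).symm.toCoalgHom.comp (pair a (pair b c)) =
      pair (pair a b) c := by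
  apply coalgHom_ext
  change (TensorProduct.assoc R U V W).symm.toLinearMap ∘ₗ
    TensorProduct.map a.toLinearMap (TensorProduct.map b.toLinearMap c.toLinearMap ∘ₗ comul) ∘ₗ
      comul = TensorProduct.map (TensorProduct.map a.toLinearMap b.toLinearMap ∘ₗ comul)
        c.toLinearMap ∘ₗ comul
  simp only [coassoc_simps]

lemma pull_mul_pull (f : U →ₗ[R] E) (g : V →ₗ[R] E) (a : C →ₗc[R] U) (b : C →ₗc[R] V) :
    pull f a * pull g b = pull (LinearMap.mul' R E ∘ₗ TensorProduct.map f g) (pair a b) := by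
  apply ofConv_injective
  change LinearMap.mul' R E ∘ₗ TensorProduct.map (f ∘ₗ a.toLinearMap) (g ∘ₗ b.toLinearMap) ∘ₗ
    comul = (LinearMap.mul' R E ∘ₗ TensorProduct.map f g) ∘ₗ
      TensorProduct.map a.toLinearMap b.toLinearMap ∘ₗ comul
  rw [TensorProduct.map_comp, LinearMap.comp_assoc, LinearMap.comp_assoc]

lemma pull_mul_pull_swap (f : U →ₗ[R] E) (g : V →ₗ[R] E) (a : C →ₗc[R] U) (b : C →ₗc[R] V) :
    pull g b * pull f a =
      pull (LinearMap.mul' R E ∘ₗ TensorProduct.map g f ∘ₗ (TensorProduct.comm R U V).toLinearMap)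
        (pair a b) := by
  rw [pull_mul_pull, pull, pull, ← comm_comp_pair b a]
  rfl

end Pair

section Hopf

variable {R C F : Type*} [CommRing R]
  [AddCommGroup C] [Module R C] [Coalgebra R C]
  [Ring F] [HopfAlgebra R F]

variable (R C F) in
/-- The convolution unit. -/
def one : C →ₗc[R] F := (Bialgebra.unitBialgHom R F).toCoalgHom.comp (counitCoalgHom R C)

lemma toConv_one : toConv (one R C F).toLinearMap = 1 := rfl

lemma toConv_toLinearMap_injective :
    Function.Injective fun a : C →ₗc[R] F => toConv a.toLinearMap := fun _ _ h =>
  coalgHom_ext (toConv_injective h)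

variable [IsCocomm R C]

/-- The convolution product of two coalgebra maps out of a cocommutative coalgebra. -/
def mul (a b : C →ₗc[R] F) : C →ₗc[R] F := (Bialgebra.mulCoalgHom R F).comp (pair a b)

lemma toConv_mul (a b : C →ₗc[R] F) :
    toConv (mul a b).toLinearMap = toConv a.toLinearMap * toConv b.toLinearMap := rfl

lemma mul_assoc (a b c : C →ₗc[R] F) : mul (mul a b) c = mul a (mul b c) :=
  toConv_toLinearMap_injective (by simp only [toConv_mul, _root_.mul_assoc])

lemma one_mul (a : C →ₗc[R] F) : mul (one R C F) a = a :=
  toConv_toLinearMap_injective (by simp only [toConv_mul, toConv_one, _root_.one_mul])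

end Hopf

section Antipode

variable {R C F : Type*} [CommRing R]
  [AddCommGroup C] [Module R C] [Coalgebra R C]
  [Ring F] [HopfAlgebra R F] [IsCocomm R F]

lemma comul_antipode :
    comul ∘ₗ HopfAlgebra.antipode R =
      TensorProduct.map (HopfAlgebra.antipode R) (HopfAlgebra.antipode R) ∘ₗ
        comul (R := R) (A := F) := by
  apply toConv_injective
  refine (left_inv_eq_right_inv (a := toConv (comul (R := R) (A := F))) ?_
    LinearMap.comul_right_inv).symm
  have h := congr(pull $(LinearMap.antipode_mul_id (R := R) (C := F ⊗[R] F)).ofConv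
    (comulCoalgHom R F))
  rwa [pull_convMul, pull_convOne] at h

variable (R F) in
/-- The antipode of a cocommutative Hopf algebra as a coalgebra map. -/
def antipode : F →ₗc[R] F where
  toLinearMap := HopfAlgebra.antipode R
  counit_comp := by ext; simp
  map_comp_comul := comul_antipode.symm

/-- The convolution inverse of a coalgebra map. -/
def inv (a : C →ₗc[R] F) : C →ₗc[R] F := (antipode R F).comp a

lemma pair_fst_snd : pair (fst R F F) (snd R F F) = CoalgHom.id R (F ⊗[R] F) := by
  apply coalgHom_ext
  ext x y
  change TensorProduct.map (fst R F F).toLinearMap (snd R F F).toLinearMap (comul (x ⊗ₜ y)) =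
    x ⊗ₜ y
  have hx : ∑ i ∈ (ℛ R x).index, counit (R := R) ((ℛ R x).right i) • (ℛ R x).left i = x := by
    have h := congr(TensorProduct.rid R F $(sum_tmul_counit_eq (ℛ R x)))
    simpa only [map_sum, TensorProduct.rid_tmul, one_smul] using h
  rw [← ((ℛ R x).tmul (ℛ R y)).eq]
  conv_rhs => rw [← hx, ← sum_counit_smul (ℛ R y)]
  simp only [Repr.tmul_index, Repr.tmul_left, Repr.tmul_right, map_sum, TensorProduct.map_tmul,
    Finset.sum_product,
    TensorProduct.sum_tmul, TensorProduct.tmul_sum]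
  rw [Finset.sum_comm]
  refine Finset.sum_congr rfl fun i _ => Finset.sum_congr rfl fun j _ => ?_
  change (fst R F F (_ ⊗ₜ _)) ⊗ₜ[R] (snd R F F (_ ⊗ₜ _)) = _
  rw [fst_tmul, snd_tmul]
  rw [TensorProduct.smul_tmul_smul, TensorProduct.smul_tmul_smul, mul_comm]

lemma inv_mul_cancel [IsCocomm R C] (a : C →ₗc[R] F) : mul (inv a) a = one R C F := by
  apply toConv_toLinearMap_injective
  have h := congr(pull $(LinearMap.antipode_mul_id (R := R) (C := F)).ofConv a)
  rwa [pull_convMul, pull_convOne] at h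

lemma inv_mul [IsCocomm R C] (a b : C →ₗc[R] F) : inv (mul a b) = mul (inv b) (inv a) := by
  apply coalgHom_ext
  change HopfAlgebra.antipode R ∘ₗ LinearMap.mul' R F ∘ₗ (pair a b).toLinearMap =
    LinearMap.mul' R F ∘ₗ TensorProduct.map (HopfAlgebra.antipode R ∘ₗ b.toLinearMap)
      (HopfAlgebra.antipode R ∘ₗ a.toLinearMap) ∘ₗ comul
  rw [← comm_comp_pair a b, TensorProduct.map_comp]
  exact congr($(HopfAlgebra.antipode_comp_mul_comp_comm (R := R) (A := F)) ∘ₗ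
    (pair b a).toLinearMap)

end Antipode

section SweedlerRepr

variable {k : Type} [Field k] {H : Type} [Ring H] [HopfAlgebra k H]

/-- The Sweedler representation of `Δ h` given by a `Coalgebra.Repr`. -/
def iterRepr {ι : Type} {h : H} (r : Repr k h ι) : IterRepr k H 1 h where
  ι := ι
  s := r.index
  leg i := ![r.left i, r.right i]
  eq := r.eq.trans congr($(LinearMap.lTensor_id (R := k) H H) (comul h)).symm

/-- A Sweedler representation of `Δ⁽³⁾ h` whose middle two legs refine one leg of `Δ⁽²⁾ h`. -/
def iterReprThree (h : H) : IterRepr k H 3 h where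
  ι := Σ _ : H × H, Σ _ : H × H, H × H
  s := (ℛ k h).index.sigma fun i => (ℛ k ((ℛ k h).right i)).index.sigma fun j =>
    (ℛ k ((ℛ k ((ℛ k h).right i)).left j)).index
  leg x := ![(ℛ k h).left x.1, (ℛ k ((ℛ k ((ℛ k h).right x.1)).left x.2.1)).left x.2.2,
    (ℛ k ((ℛ k ((ℛ k h).right x.1)).left x.2.1)).right x.2.2,
    (ℛ k ((ℛ k h).right x.1)).right x.2.1]
  eq := by
    have key (y : H) : ∑ j ∈ (ℛ k y).index, ∑ l ∈ (ℛ k ((ℛ k y).left j)).index,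
        (ℛ k ((ℛ k y).left j)).left l ⊗ₜ[k]
          ((ℛ k ((ℛ k y).left j)).right l ⊗ₜ[k] (ℛ k y).right j) =
        LinearMap.lTensor H comul (comul (R := k) y) := by
      rw [← coassoc_apply]
      conv_rhs => rw [← (ℛ k y).eq]
      simp only [map_sum, LinearMap.rTensor_tmul]
      refine Finset.sum_congr rfl fun j _ => ?_
      conv_rhs => rw [← (ℛ k ((ℛ k y).left j)).eq]
      simp only [TensorProduct.sum_tmul, map_sum, TensorProduct.assoc_tmul]
    rw [Finset.sum_sigma]
    simp only [Finset.sum_sigma]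
    change ∑ i ∈ (ℛ k h).index, ∑ j ∈ (ℛ k ((ℛ k h).right i)).index,
      ∑ l ∈ (ℛ k ((ℛ k ((ℛ k h).right i)).left j)).index,
        (ℛ k h).left i ⊗ₜ[k] ((ℛ k ((ℛ k ((ℛ k h).right i)).left j)).left l ⊗ₜ[k]
          ((ℛ k ((ℛ k ((ℛ k h).right i)).left j)).right l ⊗ₜ[k]
            (ℛ k ((ℛ k h).right i)).right j)) =
      LinearMap.lTensor H (LinearMap.lTensor H (LinearMap.lTensor H LinearMap.id ∘ₗ comul) ∘ₗ
        comul) (comul (R := k) h)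
    simp only [← TensorProduct.tmul_sum, key]
    conv_rhs => rw [← (ℛ k h).eq]
    simp only [LinearMap.lTensor_id, LinearMap.id_comp, map_sum, LinearMap.lTensor_tmul,
      LinearMap.comp_apply]

/-- The Sweedler representation `Δ⁽ⁿ⁾ 1 = 1 ⊗ ⋯ ⊗ 1`. -/
def iterReprOne (n : ℕ) : IterRepr k H n 1 where
  ι := Unit
  s := {()}
  leg _ _ := 1
  eq := by
    rw [Finset.sum_singleton]
    induction n with
    | zero => rfl
    | succ n ih =>
      change (1 : H) ⊗ₜ[k] tpow k H n (fun _ => 1) =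
        LinearMap.lTensor H (comulIter k H n) (comul (R := k) 1)
      rw [Bialgebra.comul_one, ih]
      rfl

end SweedlerRepr

section Twisted

variable {k C H M : Type} [Field k] [AddCommGroup C] [Module k C] [Coalgebra k C] [IsCocomm k C]
  [Ring H] [HopfAlgebra k H] [AddCommGroup M] [Module k M]
  {sg sg' : H →ₗ[k] H →ₗ[k] k} {mu : H →ₗ[k] H →ₗ[k] H} {lact ract : H →ₗ[k] M →ₗ[k] M}

/-- The values of a bilinear form at two points of `H`, as a convolution scalar. -/
def formAt (sg : H →ₗ[k] H →ₗ[k] k) (a b : C →ₗc[k] H) : WithConv (C →ₗ[k] k) :=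
  pull (TensorProduct.lift sg) (pair a b)

lemma pull_formAt {D : Type} [AddCommGroup D] [Module k D] [Coalgebra k D] [IsCocomm k D]
    (a b : C →ₗc[k] H) (u : D →ₗc[k] C) :
    pull (formAt sg a b).ofConv u = formAt sg (a.comp u) (b.comp u) := by
  rw [formAt, formAt, pull_pull, pair_comp]

lemma formAt_mul_formAt (hconv : IsConvInvPair k H sg sg') (a b : C →ₗc[k] H) :
    formAt sg a b * formAt sg' a b = 1 := by
  have h : toConv (TensorProduct.lift sg) * toConv (TensorProduct.lift sg') = 1 := by
    ext x y
    have h := (hconv x y (iterRepr (ℛ k x)) (iterRepr (ℛ k y))).1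
    change (toConv (TensorProduct.lift sg) * toConv (TensorProduct.lift sg')) (x ⊗ₜ y) = _
    rw [((ℛ k x).tmul (ℛ k y)).convMul_apply]
    simpa [Finset.sum_product, iterRepr, mul_comm (counit (R := k) x)] using h
  have := congr(pull $(h).ofConv (pair a b))
  rwa [pull_convMul, pull_convOne] at this

lemma formAt_one_left (hnorm : NormalK k H sg) (a : C →ₗc[k] H) :
    formAt sg (one k C H) a = 1 := by
  ext x
  change TensorProduct.lift sg (TensorProduct.map (one k C H).toLinearMap a.toLinearMap
    (comul x)) = _
  rw [← (ℛ k x).eq]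
  conv_rhs => rw [← sum_counit_smul (ℛ k x)]
  simp only [map_sum, TensorProduct.map_tmul, TensorProduct.lift.tmul]
  refine Finset.sum_congr rfl fun i _ => ?_
  change sg (algebraMap k H (counit ((ℛ k x).left i))) (a ((ℛ k x).right i)) = _
  simp [Algebra.algebraMap_eq_smul_one, (hnorm _).2]

lemma formAt_cocycle [IsCocomm k H] (hcoc : CocycleK k H sg) (a b c : C →ₗc[k] H) :
    formAt sg b c * formAt sg a (mul b c) = formAt sg a b * formAt sg (mul a b) c := by
  have h : pull (TensorProduct.lift sg) (snd k H (H ⊗[k] H)) *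
      pull (TensorProduct.lift sg)
        (Coalgebra.TensorProduct.map (CoalgHom.id k H) (Bialgebra.mulCoalgHom k H)) =
      pull (TensorProduct.lift sg)
        (Coalgebra.TensorProduct.map (CoalgHom.id k H) (fst k H H)) *
      pull (TensorProduct.lift sg)
        ((Coalgebra.TensorProduct.map (Bialgebra.mulCoalgHom k H) (CoalgHom.id k H)).comp
          (Coalgebra.TensorProduct.assoc k k H H H).symm.toCoalgHom) := by
    ext x y z
    have h := hcoc x y z (iterRepr (ℛ k x)) (iterRepr (ℛ k y)) (iterRepr (ℛ k z))
    change (_ * _ : WithConv (H ⊗[k] (H ⊗[k] H) →ₗ[k] k)) (x ⊗ₜ (y ⊗ₜ z)) =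
      (_ * _ : WithConv (H ⊗[k] (H ⊗[k] H) →ₗ[k] k)) (x ⊗ₜ (y ⊗ₜ z))
    rw [((ℛ k x).tmul ((ℛ k y).tmul (ℛ k z))).convMul_apply,
      ((ℛ k x).tmul ((ℛ k y).tmul (ℛ k z))).convMul_apply]
    simp only [Finset.sum_product, Repr.tmul_index, Repr.tmul_left, Repr.tmul_right]
    have hx (w : H) : ∑ i ∈ (ℛ k x).index, sg (counit (R := k) ((ℛ k x).left i) •
        (ℛ k x).right i) w = sg x w := by
      rw [← LinearMap.sum_apply, ← map_sum, sum_counit_smul]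
    refine Eq.trans ?_ (h.trans ?_)
    · rw [Finset.sum_comm]
      refine Finset.sum_congr rfl fun j _ => ?_
      rw [Finset.sum_comm]
      refine Finset.sum_congr rfl fun c _ => ?_
      rw [← hx, Finset.mul_sum]
      refine Finset.sum_congr rfl fun i _ => ?_
      change TensorProduct.lift sg (counit (R := k) ((ℛ k x).left i) •
        ((ℛ k y).left j ⊗ₜ[k] (ℛ k z).left c)) * sg ((ℛ k x).right i)
          ((ℛ k y).right j * (ℛ k z).right c) =
        sg ((ℛ k y).left j) ((ℛ k z).left c) * sg _ ((ℛ k y).right j * (ℛ k z).right c)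
      simp only [map_smul, LinearMap.smul_apply, TensorProduct.lift.tmul, smul_eq_mul]
      ring
    · refine Finset.sum_congr rfl fun i _ => Finset.sum_congr rfl fun j _ => ?_
      conv_lhs => rw [← sum_counit_smul (ℛ k z)]
      rw [map_sum, Finset.mul_sum]
      refine Finset.sum_congr rfl fun c _ => ?_
      change sg ((ℛ k x).left i) ((ℛ k y).left j) * _ =
        sg ((ℛ k x).left i) (counit (R := k) ((ℛ k z).left c) • (ℛ k y).left j) *
          sg ((ℛ k x).right i * (ℛ k y).right j) ((ℛ k z).right c)
      simp only [map_smul, smul_eq_mul]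
      change _ * (_ * sg ((ℛ k x).right i * (ℛ k y).right j) ((ℛ k z).right c)) = _
      ring
  have := congr(pull $(h).ofConv (pair a (pair b c)))
  rw [pull_convMul, pull_convMul] at this
  simp only [pull_pull, CoalgHom.comp_assoc, snd_comp_pair, map_comp_pair, fst_comp_pair,
    assoc_comp_pair, CoalgHom.id_comp] at this
  exact this

lemma left_mul (hmu : IsTwistMul k H sg mu) (hbim : IsSigmaBimodule k H M mu lact ract)
    (a b : C →ₗc[k] H) :
    pull (E := Module.End k M) lact a * pull lact b =
      scalar k C (Module.End k M) (formAt sg a b) * pull lact (mul a b) := by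
  have h : LinearMap.mul' k (Module.End k M) ∘ₗ TensorProduct.map lact lact =
      (scalar k (H ⊗[k] H) (Module.End k M) (toConv (TensorProduct.lift sg)) *
        pull lact (Bialgebra.mulCoalgHom k H)).ofConv := by
    ext x y m
    change lact x (lact y m) = (_ * _ : WithConv (H ⊗[k] H →ₗ[k] Module.End k M)) (x ⊗ₜ y) m
    rw [((ℛ k x).tmul (ℛ k y)).convMul_apply, hbim.1,
      hmu x y (iterRepr (ℛ k x)) (iterRepr (ℛ k y))]
    simp only [Finset.sum_product, Repr.tmul_index, Repr.tmul_left, Repr.tmul_right, map_sum,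
      LinearMap.sum_apply, map_smul]
    rfl
  rw [pull_mul_pull, h, pull_convMul]
  rfl

lemma right_mul (hmu : IsTwistMul k H sg mu) (hbim : IsSigmaBimodule k H M mu lact ract)
    (a b : C →ₗc[k] H) :
    pull (E := Module.End k M) ract b * pull ract a =
      scalar k C (Module.End k M) (formAt sg a b) * pull ract (mul a b) := by
  have h : LinearMap.mul' k (Module.End k M) ∘ₗ TensorProduct.map ract ract ∘ₗ
        (TensorProduct.comm k H H).toLinearMap =
      (scalar k (H ⊗[k] H) (Module.End k M) (toConv (TensorProduct.lift sg)) *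
        pull ract (Bialgebra.mulCoalgHom k H)).ofConv := by
    ext x y m
    change ract y (ract x m) = (_ * _ : WithConv (H ⊗[k] H →ₗ[k] Module.End k M)) (x ⊗ₜ y) m
    rw [((ℛ k x).tmul (ℛ k y)).convMul_apply, hbim.2.2.1,
      hmu x y (iterRepr (ℛ k x)) (iterRepr (ℛ k y))]
    simp only [Finset.sum_product, Repr.tmul_index, Repr.tmul_left, Repr.tmul_right, map_sum,
      LinearMap.sum_apply, map_smul]
    rfl
  rw [pull_mul_pull_swap, h, pull_convMul]
  rfl

lemma left_comm_right (hbim : IsSigmaBimodule k H M mu lact ract) (a b : C →ₗc[k] H) :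
    pull (E := Module.End k M) lact a * pull ract b = pull ract b * pull lact a :=
  convMul_comm_of_commute _ _ fun _ _ => LinearMap.ext fun _ => hbim.2.2.2.2 _ _ _

lemma triangle_eq [IsCocomm k H] (hbim : IsSigmaBimodule k H M mu lact ract)
    {B : H →ₗ[k] M →ₗ[k] M} (hB : IsTriangle k H M sg' lact ract B) (a : C →ₗc[k] H) :
    pull (E := Module.End k M) B a = pull ract (inv a) *
      (scalar k C (Module.End k M) (formAt sg' (inv a) a) * pull lact a) := by
  have h : toConv B = pull (E := Module.End k M) ract (antipode k H) *
      (scalar k H (Module.End k M) (formAt sg' (antipode k H) (CoalgHom.id k H)) *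
        pull lact (CoalgHom.id k H)) := by
    ext x m
    rw [(ℛ k x).convMul_apply]
    simp only [(ℛ k _).convMul_apply]
    have hs (y : H) : scalar k H (Module.End k M)
        (formAt sg' (antipode k H) (CoalgHom.id k H)) y = algebraMap k (Module.End k M)
          (∑ l ∈ (ℛ k y).index, sg' (HopfAlgebra.antipode k ((ℛ k y).left l))
            ((ℛ k y).right l)) := by
      change algebraMap k _ (TensorProduct.lift sg' (TensorProduct.map (antipode k H).toLinearMap
        LinearMap.id (comul y))) = _
      conv_lhs => rw [← (ℛ k y).eq]
      simp only [map_sum]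
      rfl
    rw [hB x m (iterReprThree x)]
    simp only [iterReprThree, Finset.sum_sigma]
    rw [LinearMap.sum_apply]
    refine Finset.sum_congr rfl fun i _ => ?_
    rw [Finset.mul_sum, LinearMap.sum_apply]
    refine Finset.sum_congr rfl fun j _ => ?_
    rw [hs, map_sum, Finset.sum_mul, Finset.mul_sum, LinearMap.sum_apply]
    refine Finset.sum_congr rfl fun l _ => ?_
    change _ = ract _ ((_ : k) • lact _ m)
    rw [map_smul, ← hbim.2.2.2.2]
    rfl
  have := congr(pull $(h).ofConv a)
  rw [pull_convMul, pull_convMul] at this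
  simp only [pull_pull, pull_scalar, pull_formAt, CoalgHom.id_comp] at this
  exact this

lemma formAt_relation [IsCocomm k H] (hnorm : NormalK k H sg) (hcoc : CocycleK k H sg)
    (hconv : IsConvInvPair k H sg sg') (a b : C →ₗc[k] H) :
    formAt sg' (inv a) a * formAt sg' (inv b) b * formAt sg (inv b) (inv a) * formAt sg a b =
      formAt sg' (inv (mul a b)) (mul a b) := by
  have cancel : mul (inv a) (mul a b) = b := by rw [← mul_assoc, inv_mul_cancel, one_mul]
  have h₁ := formAt_cocycle hcoc (inv b) (inv a) (mul a b)
  have h₂ := formAt_cocycle hcoc (inv a) a b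
  have ha := formAt_mul_formAt hconv (inv a) a
  have hb := formAt_mul_formAt hconv (inv b) b
  have hab := formAt_mul_formAt hconv (inv (mul a b)) (mul a b)
  rw [inv_mul] at hab ⊢
  rw [cancel] at h₁
  rw [inv_mul_cancel, formAt_one_left hnorm, _root_.mul_one] at h₂
  generalize formAt sg' (inv a) a = r₁ at *
  generalize formAt sg' (inv b) b = r₂ at *
  generalize formAt sg' (mul (inv b) (inv a)) (mul a b) = r₃ at *
  generalize formAt sg (mul (inv b) (inv a)) (mul a b) = w at *
  generalize formAt sg (inv b) b = q at *
  generalize formAt sg (inv a) a = p at *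
  generalize formAt sg (inv a) (mul a b) = x at *
  generalize formAt sg (inv b) (inv a) = v at *
  generalize formAt sg a b = u at *
  calc r₁ * r₂ * v * u = r₁ * r₂ * v * u * (w * r₃) := by rw [hab, _root_.mul_one]
    _ = r₁ * r₂ * u * (v * w) * r₃ := by ring
    _ = r₁ * r₂ * (u * x) * q * r₃ := by rw [← h₁]; ring
    _ = (p * r₁) * (q * r₂) * r₃ := by rw [h₂]; ring
    _ = r₃ := by rw [ha, hb, _root_.one_mul, _root_.one_mul]

lemma triangle_mul [IsCocomm k H] (hnorm : NormalK k H sg) (hcoc : CocycleK k H sg)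
    (hconv : IsConvInvPair k H sg sg') (hmu : IsTwistMul k H sg mu)
    (hbim : IsSigmaBimodule k H M mu lact ract) {B : H →ₗ[k] M →ₗ[k] M}
    (hB : IsTriangle k H M sg' lact ract B) (a b : C →ₗc[k] H) :
    pull (E := Module.End k M) B a * pull B b = pull B (mul a b) := by
  have hs (r : WithConv (C →ₗ[k] k)) (f : H →ₗ[k] Module.End k M) (c : C →ₗc[k] H)
      (y : WithConv (C →ₗ[k] Module.End k M)) :
      pull f c * (scalar k C (Module.End k M) r * y) =
        scalar k C (Module.End k M) r * (pull f c * y) := by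
    rw [← _root_.mul_assoc, ← scalar_mul_comm, _root_.mul_assoc]
  have hc (y : WithConv (C →ₗ[k] Module.End k M)) :
      pull (E := Module.End k M) lact a * (pull ract (inv b) * y) =
        pull ract (inv b) * (pull lact a * y) := by
    rw [← _root_.mul_assoc, left_comm_right hbim, _root_.mul_assoc]
  rw [triangle_eq hbim hB, triangle_eq hbim hB, triangle_eq hbim hB,
    ← formAt_relation hnorm hcoc hconv, inv_mul]
  simp only [map_mul, _root_.mul_assoc, hs, hc]
  rw [left_mul hmu hbim, ← _root_.mul_assoc (pull ract (inv a)), right_mul hmu hbim,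
    _root_.mul_assoc, hs]

end Twisted

end ConvPoint

/-- Let `H` be cocommutative and `σ : H ⊗ H → k` a convolution invertible
normal 2-cocycle, `H_σ = k #_σ H`, and `M` an `H_σ`-bimodule. Then
`h ▶ m = σ⁻¹(S(h⁽²⁾),h⁽³⁾)·(h⁽⁴⁾)‾ m (S(h⁽¹⁾))‾` defines a left `H`-module structure on `M`:
`g ▶ (h ▶ m) = (gh) ▶ m` and `1 ▶ m = m`. -/
theorem triangle_action_is_module
    (k : Type) [Field k] (H : Type) [Ring H] [HopfAlgebra k H]
    (hco : Cocomm k H)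
    (sg sg' : H →ₗ[k] H →ₗ[k] k)
    (hnorm : NormalK k H sg) (hcoc : CocycleK k H sg)
    (hconv : IsConvInvPair k H sg sg')
    (M : Type) [AddCommGroup M] [Module k M]
    (mu : H →ₗ[k] H →ₗ[k] H) (hmu : IsTwistMul k H sg mu)
    (lact ract : H →ₗ[k] M →ₗ[k] M)
    (hbim : IsSigmaBimodule k H M mu lact ract)
    (B : H →ₗ[k] M →ₗ[k] M) (hB : IsTriangle k H M sg' lact ract B) :
    (∀ (g h : H) (m : M), B g (B h m) = B (g * h) m) ∧ (∀ m : M, B 1 m = m) := by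
  have : IsCocomm k H := ⟨by ext x; exact hco x⟩
  refine ⟨fun g h m => ?_, fun m => ?_⟩
  · have key := ConvPoint.triangle_mul hnorm hcoc hconv hmu hbim hB
      (ConvPoint.fst k H H) (ConvPoint.snd k H H)
    rw [ConvPoint.pull_mul_pull, ConvPoint.mul, ConvPoint.pair_fst_snd] at key
    exact congr($key (g ⊗ₜ h) m)
  · have h₁ := (hconv 1 1 (ConvPoint.iterReprOne 1) (ConvPoint.iterReprOne 1)).1
    rw [hB 1 m (ConvPoint.iterReprOne 3)]
    simp only [ConvPoint.iterReprOne, Finset.sum_singleton, (hnorm 1).1, Bialgebra.counit_one,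
      HopfAlgebra.antipode_one, hbim.2.1, hbim.2.2.2.1, _root_.one_mul, _root_.mul_one] at h₁ ⊢
    rw [h₁, one_smul]
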